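/- Let n ≥ 3 and let C_n be the cycle graph on n vertices, with Grover matrix U_n (a 2n×2n matrix). Then for every complex number λ, det(λ I_{2n} − U_n) = (λ^n − 1)². In particular, the eigenvalues of U_n are exactly the n-th roots of unity e^{2πik/n}, k = 0,1,...,n−1, each with algebraic multiplicity 2. -/

import Mathlib

open SimpleGraph

/-- The Grover matrix of a finite simple graph `G`, indexed by the darts (arcs) of `G`:
`U e f = 2/deg(t(f))` if `t(f) = o(e)` and `f ≠ e⁻¹`, `U e f = 2/deg(t(f)) - 1` if `f = e⁻¹`,
and `U e f = 0` otherwise. -/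
noncomputable def groverMatrix {V : Type*} [Fintype V] [DecidableEq V] (G : SimpleGraph V)
    [DecidableRel G.Adj] : Matrix G.Dart G.Dart ℂ := fun e f =>
  if f = e.symm then 2 / (G.degree f.snd : ℂ) - 1
  else if f.snd = e.fst then 2 / (G.degree f.snd : ℂ)
  else 0

open Polynomial in
/-- The permutation matrix of an `n`-cycle is diagonalized by the discrete Fourier transform. -/
theorem charpoly_permMatrix_finRotate {K : Type*} [Field K] {n : ℕ} {ζ : K}
    (hζ : IsPrimitiveRoot ζ n) :
    ((finRotate n).permMatrix K).charpoly = ∏ k ∈ Finset.range n, (X - C (ζ ^ k)) := by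
  set F : Matrix (Fin n) (Fin n) K := (Matrix.vandermonde fun k : Fin n => ζ ^ (k : ℕ)).transpose
  have hF : IsUnit F := by
    rw [Matrix.isUnit_iff_isUnit_det, Matrix.det_transpose, isUnit_iff_ne_zero,
      Matrix.det_vandermonde_ne_zero_iff]
    exact fun i j h => Fin.ext (hζ.pow_inj i.2 j.2 h)
  have hconj : (finRotate n).permMatrix K * F =
      F * Matrix.diagonal fun k : Fin n => ζ ^ (k : ℕ) := by
    rcases n with _ | n
    · exact Subsingleton.elim _ _
    ext i k
    rw [Equiv.Perm.permMatrix, PEquiv.toMatrix_toPEquiv_mul, Matrix.mul_diagonal]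
    simp only [F, Matrix.submatrix_apply, Matrix.transpose_apply, Matrix.vandermonde_apply,
      finRotate_apply, id, ← pow_succ]
    rw [Fin.val_add, Fin.val_one', Nat.add_mod_mod, ← pow_eq_pow_mod]
    rw [← pow_mul, mul_comm, pow_mul, hζ.pow_eq_one, one_pow]
  obtain ⟨u, hu⟩ := hF
  rw [← hu] at hconj
  rw [← Matrix.charpoly_units_conj' u, mul_assoc, hconj, ← mul_assoc]
  simp [Matrix.charpoly_diagonal, Finset.prod_range]

theorem Fin.ne_add_one_add_one {m : ℕ} (i : Fin (m + 3)) : i ≠ i + 1 + 1 := by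
  rw [add_assoc, ne_eq, left_eq_add]
  exact ne_of_beq_false rfl

/-- The darts of the cycle graph: `inl i` is the dart `(i, i + 1)` and `inr i` is its reverse. -/
def cycleGraphDartEquiv (m : ℕ) : Fin (m + 3) ⊕ Fin (m + 3) ≃ (cycleGraph (m + 3)).Dart where
  toFun := Sum.elim (fun i => ⟨(i, i + 1), by simp [cycleGraph_adj]⟩)
    (fun i => ⟨(i + 1, i), by simp [cycleGraph_adj]⟩)
  invFun d := if d.snd = d.fst + 1 then Sum.inl d.fst else Sum.inr d.snd
  left_inv := by
    rintro (i | i)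
    · simp
    · simp [Fin.ne_add_one_add_one i]
  right_inv := by
    rintro ⟨⟨u, v⟩, h⟩
    rw [cycleGraph_adj, sub_eq_iff_eq_add', sub_eq_iff_eq_add'] at h
    dsimp only
    split_ifs with hv
    · ext <;> simp [hv]
    · have hu : u = v + 1 := by grind
      ext <;> simp [hu]

theorem groverMatrix_cycleGraph_apply (m : ℕ) (e f : (cycleGraph (m + 3)).Dart) :
    groverMatrix (cycleGraph (m + 3)) e f = if f.snd = e.fst ∧ f.fst ≠ e.snd then 1 else 0 := by
  have hdeg : ((cycleGraph (m + 3)).degree f.snd : ℂ) = 2 := by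
    exact_mod_cast cycleGraph_degree_three_le
  have hsymm : f = e.symm ↔ f.fst = e.snd ∧ f.snd = e.fst := by
    rw [Dart.ext_iff, Prod.ext_iff]
    rfl
  rw [groverMatrix, hdeg]
  split_ifs <;> first | tauto | norm_num

theorem groverMatrix_cycleGraph_submatrix (m : ℕ) :
    (groverMatrix (cycleGraph (m + 3))).submatrix (cycleGraphDartEquiv m) (cycleGraphDartEquiv m) =
      Matrix.fromBlocks ((finRotate (m + 3)).permMatrix ℂ).transpose 0 0
        ((finRotate (m + 3)).permMatrix ℂ) := by
  have hperm (i j : Fin (m + 3)) :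
      (finRotate (m + 3)).permMatrix ℂ i j = if j = i + 1 then 1 else 0 := by
    simp [PEquiv.toMatrix_apply, eq_comm]
  ext (i | i) (j | j) <;>
    simp only [Matrix.submatrix_apply, Matrix.fromBlocks_apply₁₁, Matrix.fromBlocks_apply₁₂,
      Matrix.fromBlocks_apply₂₁, Matrix.fromBlocks_apply₂₂, Matrix.transpose_apply,
      Matrix.zero_apply, groverMatrix_cycleGraph_apply, hperm]
  · change (if j + 1 = i ∧ j ≠ i + 1 then (1 : ℂ) else 0) = _
    grind [Fin.ne_add_one_add_one]
  · change (if j = i ∧ j + 1 ≠ i + 1 then (1 : ℂ) else 0) = _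
    grind
  · change (if j + 1 = i + 1 ∧ j ≠ i then (1 : ℂ) else 0) = _
    exact if_neg fun h => h.2 (add_right_cancel h.1)
  · change (if j = i + 1 ∧ j + 1 ≠ i then (1 : ℂ) else 0) = _
    grind [Fin.ne_add_one_add_one]

/-- For the cycle graph `Cₙ` (`n ≥ 3`) with Grover matrix `Uₙ` (a `2n × 2n` matrix),
`det(λ I - Uₙ) = (λⁿ - 1)²` for every complex `λ`; in particular the characteristic
polynomial of `Uₙ` factors as `∏_{k=0}^{n-1} (X - e^{2πik/n})²`, i.e. the eigenvalues of
`Uₙ` are exactly the `n`-th roots of unity, each with algebraic multiplicity `2`. -/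
theorem grover_charpoly_cycleGraph (n : ℕ) (hn : 3 ≤ n) :
    (∀ lam : ℂ,
      Matrix.det (lam • (1 : Matrix (cycleGraph n).Dart (cycleGraph n).Dart ℂ)
          - groverMatrix (cycleGraph n)) = (lam ^ n - 1) ^ 2) ∧
    Matrix.charpoly (groverMatrix (cycleGraph n)) =
      ∏ k ∈ Finset.range n,
        (Polynomial.X - Polynomial.C (Complex.exp (2 * Real.pi * Complex.I * k / n))) ^ 2 := by
  have hζ := Complex.isPrimitiveRoot_exp n (by omega)
  set ζ := Complex.exp (2 * Real.pi * Complex.I / n) with hζ_def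
  have hchar : (groverMatrix (cycleGraph n)).charpoly =
      (∏ k ∈ Finset.range n, (Polynomial.X - Polynomial.C (ζ ^ k))) ^ 2 := by
    obtain ⟨m, rfl⟩ := Nat.exists_eq_add_of_le' hn
    rw [← Matrix.charpoly_reindex (cycleGraphDartEquiv m).symm, Matrix.reindex_apply,
      Equiv.symm_symm, groverMatrix_cycleGraph_submatrix, Matrix.charpoly_fromBlocks_zero₁₂,
      Matrix.charpoly_transpose, charpoly_permMatrix_finRotate hζ, sq]
  refine ⟨fun lam => ?_, ?_⟩
  · have hprod := X_pow_sub_C_eq_prod hζ (by omega) (one_pow n)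
    simp only [mul_one] at hprod
    rw [Matrix.smul_one_eq_diagonal, ← Matrix.scalar_apply, ← Matrix.eval_charpoly, hchar, ← hprod]
    simp
  · rw [hchar, ← Finset.prod_pow]
    refine Finset.prod_congr rfl fun k _ => ?_
    rw [hζ_def, ← Complex.exp_nat_mul]
    ring_nf
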